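/- arXiv:math/0512494 — 3 statements merged into one kernel-verified Lean document; each statement's English description precedes it below -/
import Mathlib

section
/- Let p be a prime and let G be a finite metabelian p-group which is generated by two elements. Then Aut(G) contains a subgroup of order |γ₂(G)|², where γ₂(G) = [G,G] is the derived subgroup of G. -/
open scoped commutatorElement

/-- crossed homomorphisms into the derived subgroup -/
structure IsDer {G : Type*} [Group G] (d : G → G) : Prop where
  mem : ∀ a, d a ∈ commutator G
  mul : ∀ a b, d (a * b) = b⁻¹ * d a * b * d b

theorem isDer_one {G : Type*} [Group G] : IsDer (fun _ : G => (1 : G)) :=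
  ⟨fun _ => one_mem _, fun a b => by simp⟩

theorem IsDer.map_mul {G : Type*} [Group G]
    (hmeta : ∀ a ∈ commutator G, ∀ b ∈ commutator G, a * b = b * a)
    {d e : G → G} (hd : IsDer d) (he : IsDer e) : IsDer (fun a => d a * e a) := by
  refine ⟨fun a => mul_mem (hd.mem a) (he.mem a), fun a b => ?_⟩
  have h1 : b⁻¹ * e a * b ∈ commutator G := by
    simpa using (inferInstance : (commutator G).Normal).conj_mem _ (he.mem a) b⁻¹
  have h2 := hmeta _ (hd.mem b) _ h1
  simp only [hd.mul, he.mul]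
  calc _ = b⁻¹ * d a * b * (d b * (b⁻¹ * e a * b)) * e b := by group
    _ = _ := by rw [h2]; group

theorem IsDer.map_inv {G : Type*} [Group G]
    (hmeta : ∀ a ∈ commutator G, ∀ b ∈ commutator G, a * b = b * a)
    {d : G → G} (hd : IsDer d) : IsDer (fun a => (d a)⁻¹) := by
  refine ⟨fun a => inv_mem (hd.mem a), fun a b => ?_⟩
  have h1 : b⁻¹ * (d a)⁻¹ * b ∈ commutator G := by
    simpa using (inferInstance : (commutator G).Normal).conj_mem _ (inv_mem (hd.mem a)) b⁻¹
  have h2 := hmeta _ (inv_mem (hd.mem b)) _ h1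
  simp only [hd.mul]
  calc _ = (d b)⁻¹ * (b⁻¹ * (d a)⁻¹ * b) := by group
    _ = _ := by rw [h2]

theorem IsDer.map_conj {G : Type*} [Group G]
    (hmeta : ∀ a ∈ commutator G, ∀ b ∈ commutator G, a * b = b * a)
    {d : G → G} (hd : IsDer d) (g : G) : IsDer (fun a => g * d a * g⁻¹) := by
  refine ⟨fun a => (inferInstance : (commutator G).Normal).conj_mem _ (hd.mem a) g,
    fun a b => ?_⟩
  have h1 : ⁅g⁻¹, b⁆ ∈ commutator G :=
    Subgroup.commutator_mem_commutator (Subgroup.mem_top _) (Subgroup.mem_top _)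
  have h2 := hmeta _ (hd.mem a) _ h1
  simp only [hd.mul]
  rw [commutatorElement_def] at h2
  calc _ = b⁻¹ * g * ((g⁻¹ * b * g⁻¹⁻¹ * b⁻¹) * d a) * b * g⁻¹ * (g * d b * g⁻¹) := by group
    _ = _ := by rw [← h2]; group

theorem isDer_comm {G : Type*} [Group G] (y : G) :
    IsDer (fun a => ⁅a⁻¹, y⁆) := by
  refine ⟨fun a => Subgroup.commutator_mem_commutator (Subgroup.mem_top _) (Subgroup.mem_top _),
    fun a b => ?_⟩
  simp only [commutatorElement_def]
  group

theorem comm_le_of_gen {G : Type*} [Group G] {x y : G} (hgen : Subgroup.closure {x, y} = ⊤)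
    (U : Subgroup G) [U.Normal] (h : ⁅x, y⁆ ∈ U) : commutator G ≤ U := by
  have hxy : (x : G ⧸ U) * y = y * x := by
    rw [← commutatorElement_eq_one_iff_mul_comm]
    exact (QuotientGroup.eq_one_iff _).2 h
  have key : ∀ a : G, (a : G ⧸ U) ∈ Subgroup.closure ({(x : G ⧸ U), (y : G ⧸ U)} : Set (G ⧸ U)) := by
    intro a
    have : a ∈ Subgroup.closure {x, y} := by rw [hgen]; trivial
    have h2 := Subgroup.mem_map_of_mem (QuotientGroup.mk' U) this
    rw [MonoidHom.map_closure, Set.image_pair] at h2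
    exact h2
  have hc : ∀ s ∈ ({(x : G ⧸ U), (y : G ⧸ U)} : Set (G ⧸ U)),
      ∀ t ∈ ({(x : G ⧸ U), (y : G ⧸ U)} : Set (G ⧸ U)), s * t = t * s := by
    rintro s (rfl | rfl) t (rfl | rfl) <;> simp [hxy]
  have hcc := Subgroup.isMulCommutative_closure hc
  rw [commutator_def, Subgroup.commutator_le]
  intro a _ b _
  rw [← QuotientGroup.eq_one_iff]
  change ⁅(a : G ⧸ U), (b : G ⧸ U)⁆ = 1
  rw [commutatorElement_eq_one_iff_mul_comm]
  exact congrArg Subtype.val (hcc.is_comm.comm ⟨_, key a⟩ ⟨_, key b⟩)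

theorem exists_der_half {G : Type*} [Group G] {x y : G} (hgen : Subgroup.closure {x, y} = ⊤)
    (hmeta : ∀ a ∈ commutator G, ∀ b ∈ commutator G, a * b = b * a)
    (u : G) (hu : u ∈ commutator G) : ∃ d : G → G, IsDer d ∧ d x = u ∧ d y = 1 := by
  let U : Subgroup G :=
    { carrier := {u | ∃ d : G → G, IsDer d ∧ d x = u ∧ d y = 1}
      one_mem' := ⟨_, isDer_one, rfl, rfl⟩
      mul_mem' := by
        rintro _ _ ⟨d, hd, rfl, hy⟩ ⟨e, he, rfl, hy'⟩
        exact ⟨_, hd.map_mul hmeta he, rfl, by simp [hy, hy']⟩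
      inv_mem' := by
        rintro _ ⟨d, hd, rfl, hy⟩
        exact ⟨_, hd.map_inv hmeta, rfl, by simp [hy]⟩ }
  have hU : U.Normal := ⟨by
    rintro _ ⟨d, hd, rfl, hy⟩ g
    exact ⟨_, hd.map_conj hmeta g, rfl, by simp [hy]⟩⟩
  have h1 : ⁅x⁻¹, y⁆ ∈ U := ⟨_, isDer_comm y, rfl, by simp [commutatorElement_def]⟩
  have h2 : ⁅x, y⁆ ∈ U := by
    have := hU.conj_mem _ (inv_mem h1) x
    simp only [commutatorElement_def] at this ⊢
    convert this using 1
    group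
  exact comm_le_of_gen hgen U h2 hu

theorem exists_der {G : Type*} [Group G] {x y : G} (hgen : Subgroup.closure {x, y} = ⊤)
    (hmeta : ∀ a ∈ commutator G, ∀ b ∈ commutator G, a * b = b * a)
    (u v : G) (hu : u ∈ commutator G) (hv : v ∈ commutator G) :
    ∃ d : G → G, IsDer d ∧ d x = u ∧ d y = v := by
  obtain ⟨d, hd, rfl, h1⟩ := exists_der_half hgen hmeta u hu
  obtain ⟨e, he, rfl, h2⟩ := exists_der_half (x := y) (y := x)
    (by rw [Set.pair_comm]; exact hgen) hmeta v hv
  exact ⟨_, hd.map_mul hmeta he, by simp [h2], by simp [h1]⟩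

theorem top_of_sup {p : ℕ} (hp : p.Prime) {G : Type*} [Group G] [Finite G]
    (hpG : IsPGroup p G) (R : Subgroup G) (hR : R ⊔ commutator G = ⊤) : R = ⊤ := by
  have := Fact.mk hp
  have : Group.IsNilpotent G := hpG.isNilpotent
  rcases eq_top_or_exists_le_coatom R with h | ⟨M, hM, hRM⟩
  · exact h
  exfalso
  have hn : M.Normal := Subgroup.NormalizerCondition.normal_of_coatom M Group.normalizerCondition_of_isNilpotent hM
  have hM2 : M ⊔ commutator G = ⊤ := top_le_iff.1 (hR ▸ sup_le_sup_right hRM _)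
  have : Nontrivial (G ⧸ M) := QuotientGroup.nontrivial_iff.2 hM.1
  have h1 : commutator (G ⧸ M) < ⊤ := Group.IsSolvable.commutator_lt_top_of_nontrivial (G ⧸ M)
  apply h1.ne
  have h2 : (commutator G).map (QuotientGroup.mk' M) = commutator (G ⧸ M) := by
    rw [commutator_def, Subgroup.map_commutator, commutator_def,
      Subgroup.map_top_of_surjective _ (QuotientGroup.mk'_surjective M)]
  have h3 := congrArg (Subgroup.map (QuotientGroup.mk' M)) hM2
  rw [Subgroup.map_sup, h2, QuotientGroup.map_mk'_self, bot_sup_eq,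
    Subgroup.map_top_of_surjective _ (QuotientGroup.mk'_surjective M)] at h3
  exact h3

/-- automorphisms inducing the identity modulo the derived subgroup -/
def autId (G : Type*) [Group G] : Subgroup (MulAut G) where
  carrier := {α | ∀ g, g⁻¹ * α g ∈ commutator G}
  one_mem' := fun g => by simp
  mul_mem' := by
    intro α β ha hb g
    have := mul_mem (hb g) (ha (β g))
    simpa [mul_assoc] using this
  inv_mem' := by
    intro α ha g
    have := inv_mem (ha (α⁻¹ g))
    simpa using this

theorem stmt1 {p : ℕ} (hp : p.Prime) {G : Type*} [Group G] [Finite G]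
    (hpG : IsPGroup p G)
    (hmeta : ∀ a ∈ commutator G, ∀ b ∈ commutator G, a * b = b * a)
    (hgen : ∃ x y : G, Subgroup.closure {x, y} = ⊤) :
    ∃ H : Subgroup (MulAut G), Nat.card H = Nat.card (commutator G) ^ 2 := by
  obtain ⟨x, y, hgen⟩ := hgen
  refine ⟨autId G, ?_⟩
  rw [sq, ← Nat.card_prod]
  refine Nat.card_congr (Equiv.ofBijective
    (fun α : autId G => ((⟨_, α.2 x⟩ : commutator G), (⟨_, α.2 y⟩ : commutator G))) ⟨?_, ?_⟩)
  · intro α β h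
    simp only [Prod.mk.injEq, Subtype.mk.injEq, mul_right_inj] at h
    apply Subtype.ext
    have : (α : MulAut G).toMonoidHom = (β : MulAut G).toMonoidHom := by
      apply MonoidHom.eq_of_eqOn_dense hgen
      rintro s (rfl | rfl)
      · exact h.1
      · exact h.2
    ext g
    exact DFunLike.congr_fun this g
  · rintro ⟨⟨u, hu⟩, ⟨v, hv⟩⟩
    obtain ⟨d, hd, rfl, rfl⟩ := exists_der hgen hmeta u v hu hv
    let φ : G →* G := MonoidHom.mk' (fun a => a * d a) (fun a b => by
      simp only [hd.mul]; group)
    have hφ : ∀ a, φ a = a * d a := fun a => rfl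
    have hs : Function.Surjective φ := by
      rw [← MonoidHom.range_eq_top]
      apply top_of_sup hp hpG
      rw [eq_top_iff]
      intro a _
      have : a = φ a * (d a)⁻¹ := by simp [hφ]
      rw [this]
      exact Subgroup.mul_mem_sup ⟨a, rfl⟩ (inv_mem (hd.mem a))
    let α : MulAut G := MulEquiv.ofBijective φ ⟨Finite.injective_iff_surjective.2 hs, hs⟩
    have hα : ∀ a, α a = a * d a := fun a => rfl
    refine ⟨⟨α, fun g => by simpa [hα] using hd.mem g⟩, ?_⟩
    simp [hα]
end

section
/- Let A be an abelian normal subgroup of a group G and let δ : G → A be a derivation with δ(δ(g)) = 1 for all g ∈ G (for instance, this holds whenever A ⊆ ker δ). Then 1+δ is an automorphism of G, with inverse the map g ↦ g·δ(g)⁻¹ composed appropriately; explicitly, 1−δ : g ↦ g·δ(g)⁻¹ is a two-sided inverse of 1+δ. -/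
/-- A derivation of a group `G` into an abelian normal subgroup `A` (written
multiplicatively): a map `δ : G → G` with values in `A` satisfying
`δ(gh) = δ(g)^h · δ(h)`, where `x^h = h⁻¹xh`. -/
def IsDerivation {G : Type*} [Group G] (A : Subgroup G) (δ : G → G) : Prop :=
  (∀ g : G, δ g ∈ A) ∧ ∀ g h : G, δ (g * h) = h⁻¹ * δ g * h * δ h

/-- Let `A` be an abelian normal subgroup of `G` and `δ : G → A` a derivation
with `δ(δ(g)) = 1` for all `g`.  Then `1 + δ : g ↦ g·δ(g)` is an automorphism of
`G`, with two-sided inverse `1 - δ : g ↦ g·δ(g)⁻¹`. -/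
theorem stmt10 {G : Type*} [Group G] (A : Subgroup G) (hA : A.Normal)
    (hab : ∀ a ∈ A, ∀ b ∈ A, a * b = b * a)
    (δ : G → G) (hδ : IsDerivation A δ) (hnil : ∀ g : G, δ (δ g) = 1) :
    -- `1 + δ` is an automorphism of `G` ...
    (∃ φ : MulAut G, ∀ g : G, φ g = g * δ g) ∧
    -- ... and `1 - δ` is a two-sided inverse of `1 + δ`:
    (∀ g : G, (g * δ g) * (δ (g * δ g))⁻¹ = g) ∧
    (∀ g : G, (g * (δ g)⁻¹) * δ (g * (δ g)⁻¹) = g) := by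
  obtain ⟨-, hd⟩ := hδ
  have h1 : δ 1 = 1 := by simpa using hd 1 1
  have hp : ∀ g, δ (g * δ g) = δ g := by
    intro g
    rw [hd, hnil]
    group
  have hi : ∀ g, δ ((δ g)⁻¹) = 1 := by
    intro g
    have h := hd (δ g) (δ g)⁻¹
    rw [hnil, mul_inv_cancel, h1] at h
    simpa using h.symm
  have hm : ∀ g, δ (g * (δ g)⁻¹) = δ g := by
    intro g
    rw [hd, hi]
    group
  have hl : ∀ g : G, (g * δ g) * (δ (g * δ g))⁻¹ = g := by
    intro g
    rw [hp, mul_inv_cancel_right]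
  have hr : ∀ g : G, (g * (δ g)⁻¹) * δ (g * (δ g)⁻¹) = g := by
    intro g
    rw [hm, inv_mul_cancel_right]
  refine ⟨⟨{ toFun := fun g => g * δ g
             invFun := fun g => g * (δ g)⁻¹
             left_inv := hl
             right_inv := hr
             map_mul' := ?_ }, fun _ => rfl⟩, hl, hr⟩
  intro g h
  simp only [hd]
  group
end

section
/- Let G be a finite group and let A be an abelian normal subgroup of G contained in the Frattini subgroup Φ(G). Then for every derivation δ : G → A, the map 1+δ : g ↦ g·δ(g) is an automorphism of G. -/
/-- Let `G` be a finite group and `A` an abelian normal subgroup of `G` contained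
in the Frattini subgroup `Φ(G)`.  Then for every derivation `δ : G → A`, the map
`1 + δ : g ↦ g·δ(g)` is an automorphism of `G`. -/
theorem stmt11 {G : Type*} [Group G] [Finite G] (A : Subgroup G) (hA : A.Normal)
    (hab : ∀ a ∈ A, ∀ b ∈ A, a * b = b * a)
    (hfr : A ≤ frattini G)
    (δ : G → G) (hδ : IsDerivation A δ) :
    ∃ φ : MulAut G, ∀ g : G, φ g = g * δ g := by
  obtain ⟨h1, h2⟩ := hδ
  let f : G →* G := MonoidHom.mk' (fun g => g * δ g) (by
    intro a b
    simp only [h2]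
    group)
  have hf : ∀ g, f g = g * δ g := fun g => rfl
  have hr : f.range = ⊤ := by
    apply frattini_nongenerating
    rw [eq_top_iff]
    intro g _
    have hg : g = f g * (δ g)⁻¹ := by rw [hf]; group
    rw [hg]
    exact mul_mem (Subgroup.mem_sup_left ⟨g, rfl⟩)
      (Subgroup.mem_sup_right (inv_mem (hfr (h1 g))))
  have hs : Function.Surjective f := MonoidHom.range_eq_top.mp hr
  exact ⟨MulEquiv.ofBijective f ⟨Finite.injective_iff_surjective.mpr hs, hs⟩, fun g => rfl⟩
end
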